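/- arXiv:2601.20733 — 10 statements merged into one kernel-verified Lean document; each statement's English description precedes it below -/
import Mathlib

section
/- Let κ > 0 and γ > 2κ. Define s = √(γ⁴ + γ³√(γ²−4κ²) − 4γ²κ² − 2γ√(γ²−4κ²)κ² + 2κ⁴), and set β₁ = (3√2·γ²·s + 7γ⁴ + 7γ³√(γ²−4κ²) − 24γ²κ² − 10γ√(γ²−4κ²)κ² + 20κ⁴)/(4κ³), β₂ = (3√2·γ²·s − γ⁴ − γ³√(γ²−4κ²) − 2γ√(γ²−4κ²)κ² + 4κ⁴)/(4κ³), β₃ = −(3√2·γ²·s − 7γ⁴ − 7γ³√(γ²−4κ²) + 24γ²κ² + 10γ√(γ²−4κ²)κ² − 20κ⁴)/(4κ³), β₄ = −(3√2·γ²·s + γ⁴ + γ³√(γ²−4κ²) + 2γ√(γ²−4κ²)κ² − 4κ⁴)/(4κ³). Then β₄ < β₂ < β₃ < β₁ and β₄ < 0. -/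
theorem beta_ordering_B_plus (κ γ : ℝ) (hκ : 0 < κ) (hγ : 2 * κ < γ)
    (d s β₁ β₂ β₃ β₄ : ℝ)
    (hd : d = Real.sqrt (γ ^ 2 - 4 * κ ^ 2))
    (hs : s = Real.sqrt (γ ^ 4 + γ ^ 3 * d - 4 * γ ^ 2 * κ ^ 2 - 2 * γ * d * κ ^ 2 + 2 * κ ^ 4))
    (hβ₁ : β₁ = (3 * Real.sqrt 2 * γ ^ 2 * s + 7 * γ ^ 4 + 7 * γ ^ 3 * d
      - 24 * γ ^ 2 * κ ^ 2 - 10 * γ * d * κ ^ 2 + 20 * κ ^ 4) / (4 * κ ^ 3))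
    (hβ₂ : β₂ = (3 * Real.sqrt 2 * γ ^ 2 * s - γ ^ 4 - γ ^ 3 * d
      - 2 * γ * d * κ ^ 2 + 4 * κ ^ 4) / (4 * κ ^ 3))
    (hβ₃ : β₃ = -((3 * Real.sqrt 2 * γ ^ 2 * s - 7 * γ ^ 4 - 7 * γ ^ 3 * d
      + 24 * γ ^ 2 * κ ^ 2 + 10 * γ * d * κ ^ 2 - 20 * κ ^ 4) / (4 * κ ^ 3)))
    (hβ₄ : β₄ = -((3 * Real.sqrt 2 * γ ^ 2 * s + γ ^ 4 + γ ^ 3 * d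
      + 2 * γ * d * κ ^ 2 - 4 * κ ^ 4) / (4 * κ ^ 3))) :
    β₄ < β₂ ∧ β₂ < β₃ ∧ β₃ < β₁ ∧ β₄ < 0 := by
  have hD : 0 < γ ^ 2 - 4 * κ ^ 2 := by nlinarith
  have hd0 : 0 < d := by rw [hd]; exact Real.sqrt_pos.mpr hD
  have hd2 : d ^ 2 = γ ^ 2 - 4 * κ ^ 2 := by rw [hd]; exact Real.sq_sqrt hD.le
  have hdγ : d < γ := by nlinarith [pow_pos hκ 2]
  clear hd
  obtain ⟨p, hp⟩ : ∃ p, p = (γ + d) / 2 := ⟨_, rfl⟩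
  obtain ⟨q, hq⟩ : ∃ q, q = (γ - d) / 2 := ⟨_, rfl⟩
  have hq0 : 0 < q := by linarith
  have hpq : 0 < p - q := by linarith
  have hp0 : 0 < p := by linarith
  have eγ : γ = p + q := by linarith
  have ed : d = p - q := by linarith
  have k2 : κ ^ 2 = p * q := by rw [hp, hq]; linarith
  have k4 : κ ^ 4 = p ^ 2 * q ^ 2 := by
    calc κ ^ 4 = (κ ^ 2) ^ 2 := by ring
      _ = _ := by rw [k2]; ring
  have hs' : s = Real.sqrt 2 * p ^ 2 := by
    rw [hs, k2, k4, eγ, ed, ← Real.sqrt_sq (by positivity : 0 ≤ Real.sqrt 2 * p ^ 2)]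
    congr 1
    rw [mul_pow, Real.sq_sqrt (by norm_num)]
    ring
  have hT : 3 * Real.sqrt 2 * γ ^ 2 * s = 6 * (p + q) ^ 2 * p ^ 2 := by
    rw [hs', eγ]
    have h2 : Real.sqrt 2 * Real.sqrt 2 = 2 := Real.mul_self_sqrt (by norm_num)
    linear_combination 3 * (p + q) ^ 2 * p ^ 2 * h2
  have hk3 : 0 < 4 * κ ^ 3 := by positivity
  rw [hT, k2, k4, eγ, ed] at hβ₁ hβ₂ hβ₃ hβ₄
  rw [← neg_div] at hβ₃ hβ₄
  have hTp : 0 < 6 * (p + q) ^ 2 * p ^ 2 := by positivity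
  have h23 : 0 < p ^ 2 * (p - q) ^ 2 := by positivity
  have h4 : 0 < p ^ 4 + p ^ 3 * q + p * q ^ 3 + p ^ 2 * q ^ 2 := by positivity
  have a1 : 0 < p ^ 4 := by positivity
  have a2 : 0 < p ^ 3 * q := by positivity
  have a3 : 0 < p ^ 2 * q ^ 2 := by positivity
  have a4 : 0 < p * q ^ 3 := by positivity
  refine ⟨?_, ?_, ?_, ?_⟩
  · rw [hβ₄, hβ₂, div_lt_div_iff_of_pos_right hk3]
    linarith
  · rw [hβ₃, hβ₂, div_lt_div_iff_of_pos_right hk3]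
    linarith
  · rw [hβ₃, hβ₁, div_lt_div_iff_of_pos_right hk3]
    linarith
  · rw [hβ₄]
    apply div_neg_of_neg_of_pos _ hk3
    nlinarith
end

section
/- For every k ∈ (0,1), with r(k) = √(k⁴ − k² + 1): 2/3 < (1 + r(k))/(2 − k² + r(k)) < 1. -/
theorem snoidal_q_tilde_range (k : ℝ) (hk0 : 0 < k) (hk1 : k < 1) :
    2 / 3 < (1 + Real.sqrt (k ^ 4 - k ^ 2 + 1)) / (2 - k ^ 2 + Real.sqrt (k ^ 4 - k ^ 2 + 1)) ∧
      (1 + Real.sqrt (k ^ 4 - k ^ 2 + 1)) / (2 - k ^ 2 + Real.sqrt (k ^ 4 - k ^ 2 + 1)) < 1 := by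
  have h0 : 0 < k ^ 2 := by positivity
  have h1 : k ^ 2 < 1 := by nlinarith
  have hr : 1 - 2 * k ^ 2 < Real.sqrt (k ^ 4 - k ^ 2 + 1) := by
    apply Real.lt_sqrt_of_sq_lt
    nlinarith [mul_pos h0 (sub_pos.2 h1)]
  have hn := Real.sqrt_nonneg (k ^ 4 - k ^ 2 + 1)
  have hd : 0 < 2 - k ^ 2 + Real.sqrt (k ^ 4 - k ^ 2 + 1) := by linarith
  constructor
  · rw [lt_div_iff₀ hd]; linarith
  · rw [div_lt_one hd]; linarith
end

section
/- For every k ∈ (0,1): (2 − k² + 2√(k⁴ − k² + 1)) · K(k)² > π², where K(k) = ∫₀^{π/2} (1 − k² sin²θ)^{−1/2} dθ is the complete elliptic integral of the first kind. -/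
open Real

/-- The complete elliptic integral of the first kind. -/
noncomputable def ellipticK (k : ℝ) : ℝ :=
  ∫ θ in (0 : ℝ)..(π / 2), 1 / Real.sqrt (1 - k ^ 2 * Real.sin θ ^ 2)

/-- Tangent-line (Jensen) lower bound for the elliptic integral. -/
lemma ellipticK_lower (k : ℝ) (hk0 : 0 < k) (hk1 : k < 1) (b : ℝ) (hb : 0 < b)
    (hb2 : b ^ 2 = 1 - k ^ 2 / 2) : π / (2 * b) ≤ ellipticK k := by
  have hk2 : k ^ 2 < 1 := by nlinarith
  have hpos : ∀ θ : ℝ, 0 < 1 - k ^ 2 * Real.sin θ ^ 2 := by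
    intro θ
    have h1 := Real.sin_sq_le_one θ
    nlinarith [sq_nonneg k, sq_nonneg (Real.sin θ)]
  have hint : ∫ θ in (0 : ℝ)..(π / 2),
      ((3 * b ^ 2 - 1) / (2 * b ^ 3) + k ^ 2 / (2 * b ^ 3) * Real.sin θ ^ 2) = π / (2 * b) := by
    rw [intervalIntegral.integral_add (by simp)
      (Continuous.intervalIntegrable (by fun_prop) _ _),
      intervalIntegral.integral_const_mul, integral_sin_sq]
    have hk : k ^ 2 = 2 - 2 * b ^ 2 := by linarith
    simp [hk]
    field_simp
    ring
  rw [← hint]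
  unfold ellipticK
  apply intervalIntegral.integral_mono_on (by positivity)
  · exact Continuous.intervalIntegrable (by fun_prop) _ _
  · apply Continuous.intervalIntegrable
    apply Continuous.div continuous_const (by fun_prop)
    intro θ
    exact (Real.sqrt_pos.mpr (hpos θ)).ne'
  · intro θ _
    have hu := Real.sqrt_pos.mpr (hpos θ)
    have hu2 := Real.sq_sqrt (hpos θ).le
    set u := Real.sqrt (1 - k ^ 2 * Real.sin θ ^ 2)
    have e : (3 * b ^ 2 - 1) / (2 * b ^ 3) + k ^ 2 / (2 * b ^ 3) * Real.sin θ ^ 2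
        = (3 * b ^ 2 - u ^ 2) / (2 * b ^ 3) := by
      rw [hu2]; ring
    rw [e, div_le_div_iff₀ (by positivity) hu]
    have : 0 ≤ (u - b) ^ 2 * (u + 2 * b) := by positivity
    nlinarith

theorem cnoidal_amplitude_range (k : ℝ) (hk0 : 0 < k) (hk1 : k < 1) :
    (2 - k ^ 2 + 2 * Real.sqrt (k ^ 4 - k ^ 2 + 1)) * ellipticK k ^ 2 > π ^ 2 := by
  have hk2 : k ^ 2 < 1 := by nlinarith
  have ha : 0 < 1 - k ^ 2 / 2 := by linarith
  have hb := Real.sqrt_pos.mpr ha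
  have hb2 := Real.sq_sqrt ha.le
  have hK := ellipticK_lower k hk0 hk1 _ hb hb2
  set b := Real.sqrt (1 - k ^ 2 / 2)
  have hs : 1 - k ^ 2 / 2 < Real.sqrt (k ^ 4 - k ^ 2 + 1) := by
    apply Real.lt_sqrt_of_sq_lt
    have : 0 < k ^ 4 := by positivity
    nlinarith
  have hp : 0 < π / (2 * b) := by positivity
  have h2 : (π / (2 * b)) ^ 2 ≤ ellipticK k ^ 2 := by gcongr
  have h3 : 4 * b ^ 2 * (π / (2 * b)) ^ 2 = π ^ 2 := by field_simp; ring
  have h4 : 0 < ellipticK k ^ 2 := lt_of_lt_of_le (by positivity) h2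
  have h5 : 4 * b ^ 2 < 2 - k ^ 2 + 2 * Real.sqrt (k ^ 4 - k ^ 2 + 1) := by linarith
  calc π ^ 2 = 4 * b ^ 2 * (π / (2 * b)) ^ 2 := h3.symm
    _ ≤ 4 * b ^ 2 * ellipticK k ^ 2 := by gcongr
    _ < _ := mul_lt_mul_of_pos_right h5 h4
end

section
/- The function k ↦ K(k)² · √(k⁴ − k² + 1) is strictly increasing on the interval (0,1), where K(k) = ∫₀^{π/2} (1 − k² sin²θ)^{−1/2} dθ is the complete elliptic integral of the first kind. -/
open Real

lemma aux_sq (x : ℝ) (h : x ^ 2 < 1) :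
    (1 / √(1 + x) + 1 / √(1 - x)) ^ 2 = 2 / (1 - x ^ 2) + 2 / √(1 - x ^ 2) := by
  obtain ⟨h1, h2⟩ := abs_lt.mp ((sq_lt_one_iff_abs_lt_one x).mp h)
  have p1 : 0 < 1 + x := by linarith
  have p2 : 0 < 1 - x := by linarith
  have e : √(1 - x ^ 2) = √(1 + x) * √(1 - x) := by
    rw [← Real.sqrt_mul p1.le]; congr 1; ring
  have q1 := Real.sqrt_pos.mpr p1
  have q2 := Real.sqrt_pos.mpr p2
  have s1 := Real.sq_sqrt p1.le
  have s2 := Real.sq_sqrt p2.le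
  have e2 : 1 - x ^ 2 = √(1 + x) ^ 2 * √(1 - x) ^ 2 := by rw [s1, s2]; ring
  rw [e, e2]
  have e3 : √(1 + x) ^ 2 + √(1 - x) ^ 2 = 2 := by rw [s1, s2]; ring
  generalize √(1 + x) = a at *
  generalize √(1 - x) = b at *
  field_simp
  linarith

lemma aux_mono (x y : ℝ) (hxy : x ^ 2 ≤ y ^ 2) (h : y ^ 2 < 1) :
    1 / √(1 + x) + 1 / √(1 - x) ≤ 1 / √(1 + y) + 1 / √(1 - y) := by
  refine (sq_le_sq₀ (by positivity) (by positivity)).mp ?_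
  rw [aux_sq x (by linarith), aux_sq y h]
  have p : 0 < 1 - y ^ 2 := by linarith
  have q := Real.sqrt_pos.mpr p
  gcongr

/-- The modified integral, as a function of `t = k² / (2 - k²)`. -/
noncomputable def auxH (t : ℝ) : ℝ :=
  ∫ θ in (0 : ℝ)..(π / 2), 1 / √(1 + t * Real.cos (2 * θ))

lemma aux_pos (t : ℝ) (h0 : 0 ≤ t) (h1 : t < 1) (θ : ℝ) : 0 < 1 + t * Real.cos (2 * θ) := by
  nlinarith [Real.neg_one_le_cos (2 * θ)]

lemma aux_pos' (t : ℝ) (h0 : 0 ≤ t) (h1 : t < 1) (θ : ℝ) : 0 < 1 - t * Real.cos (2 * θ) := by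
  nlinarith [Real.cos_le_one (2 * θ)]

lemma aux_cont (t : ℝ) (h0 : 0 ≤ t) (h1 : t < 1) :
    Continuous fun θ : ℝ => 1 / √(1 + t * Real.cos (2 * θ)) :=
  Continuous.div (by fun_prop) (by fun_prop)
    fun θ => (Real.sqrt_pos.mpr (aux_pos t h0 h1 θ)).ne'

lemma aux_cont' (t : ℝ) (h0 : 0 ≤ t) (h1 : t < 1) :
    Continuous fun θ : ℝ => 1 / √(1 - t * Real.cos (2 * θ)) :=
  Continuous.div (by fun_prop) (by fun_prop)
    fun θ => (Real.sqrt_pos.mpr (aux_pos' t h0 h1 θ)).ne'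

lemma auxH_refl (t : ℝ) :
    auxH t = ∫ θ in (0 : ℝ)..(π / 2), 1 / √(1 - t * Real.cos (2 * θ)) := by
  have h := intervalIntegral.integral_comp_sub_left (a := 0) (b := π / 2)
    (fun θ : ℝ => 1 / √(1 + t * Real.cos (2 * θ))) (π / 2)
  simp only [sub_self, sub_zero] at h
  rw [auxH, ← h]
  congr 1
  ext θ
  have : Real.cos (2 * (π / 2 - θ)) = - Real.cos (2 * θ) := by
    rw [← Real.cos_pi_sub]; congr 1; ring
  rw [this]; congr 2; ring

lemma auxH_two (t : ℝ) (h0 : 0 ≤ t) (h1 : t < 1) :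
    2 * auxH t = ∫ θ in (0 : ℝ)..(π / 2),
      (1 / √(1 + t * Real.cos (2 * θ)) + 1 / √(1 - t * Real.cos (2 * θ))) := by
  rw [intervalIntegral.integral_add ((aux_cont t h0 h1).intervalIntegrable _ _)
    ((aux_cont' t h0 h1).intervalIntegrable _ _), ← auxH_refl]
  rw [two_mul]; rfl

lemma auxH_mono (s t : ℝ) (h0 : 0 ≤ s) (hst : s ≤ t) (h1 : t < 1) : auxH s ≤ auxH t := by
  have h0t := h0.trans hst
  have h1s := hst.trans_lt h1
  suffices 2 * auxH s ≤ 2 * auxH t by linarith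
  rw [auxH_two s h0 h1s, auxH_two t h0t h1]
  apply intervalIntegral.integral_mono_on (by positivity)
    (((aux_cont s h0 h1s).add (aux_cont' s h0 h1s)).intervalIntegrable _ _)
    (((aux_cont t h0t h1).add (aux_cont' t h0t h1)).intervalIntegrable _ _)
  intro θ _
  apply aux_mono
  · rw [mul_pow, mul_pow]; gcongr
  · rw [mul_pow]
    have : Real.cos (2 * θ) ^ 2 ≤ 1 := Real.cos_sq_le_one _
    nlinarith [sq_nonneg t]

lemma auxH_pos (t : ℝ) (h0 : 0 ≤ t) (h1 : t < 1) : 0 < auxH t := by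
  apply intervalIntegral.intervalIntegral_pos_of_pos
    ((aux_cont t h0 h1).intervalIntegrable _ _)
  · intro θ
    have := Real.sqrt_pos.mpr (aux_pos t h0 h1 θ)
    positivity
  · positivity

lemma freq_eq (k : ℝ) (h0 : 0 < k) (h1 : k < 1) :
    ellipticK k ^ 2 * √(k ^ 4 - k ^ 2 + 1) =
      auxH (k ^ 2 / (2 - k ^ 2)) ^ 2 * √(1 + 3 * (k ^ 2 / (2 - k ^ 2)) ^ 2) := by
  have hk : k ^ 2 < 1 := by nlinarith
  have hp : 0 < 1 - k ^ 2 / 2 := by linarith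
  have hq : 2 - k ^ 2 ≠ 0 := by linarith
  have e1 : ellipticK k = (1 / √(1 - k ^ 2 / 2)) * auxH (k ^ 2 / (2 - k ^ 2)) := by
    rw [ellipticK, auxH, ← intervalIntegral.integral_const_mul]
    congr 1
    ext θ
    rw [div_mul_div_comm, one_mul, ← Real.sqrt_mul hp.le]
    congr 2
    rw [Real.cos_two_mul, Real.sin_sq]
    field_simp
    ring
  have e2 : √(k ^ 4 - k ^ 2 + 1) =
      (1 - k ^ 2 / 2) * √(1 + 3 * (k ^ 2 / (2 - k ^ 2)) ^ 2) := by
    rw [← Real.sqrt_sq hp.le, ← Real.sqrt_mul (sq_nonneg _)]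
    congr 1
    field_simp
    ring
  rw [e1, e2, mul_pow, div_pow, Real.sq_sqrt hp.le]
  field_simp

theorem frequency_strict_mono :
    StrictMonoOn (fun k : ℝ => ellipticK k ^ 2 * Real.sqrt (k ^ 4 - k ^ 2 + 1))
      (Set.Ioo (0 : ℝ) 1) := by
  rintro a ⟨ha0, ha1⟩ b ⟨hb0, hb1⟩ hab
  simp only
  rw [freq_eq a ha0 ha1, freq_eq b hb0 hb1]
  have hb : b ^ 2 < 1 := by nlinarith
  have hab2 : a ^ 2 < b ^ 2 := by nlinarith
  have hs : 0 ≤ a ^ 2 / (2 - a ^ 2) := div_nonneg (sq_nonneg _) (by linarith)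
  have ht : b ^ 2 / (2 - b ^ 2) < 1 := by rw [div_lt_one (by linarith)]; linarith
  have hst : a ^ 2 / (2 - a ^ 2) < b ^ 2 / (2 - b ^ 2) := by
    rw [div_lt_div_iff₀ (by linarith) (by linarith)]; nlinarith
  generalize a ^ 2 / (2 - a ^ 2) = s at *
  generalize b ^ 2 / (2 - b ^ 2) = t at *
  have hH := auxH_mono s t hs hst.le ht
  have hHs := auxH_pos s hs (hst.trans ht)
  have hsq : √(1 + 3 * s ^ 2) < √(1 + 3 * t ^ 2) := by
    apply Real.sqrt_lt_sqrt (by positivity)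
    nlinarith
  calc auxH s ^ 2 * √(1 + 3 * s ^ 2) < auxH s ^ 2 * √(1 + 3 * t ^ 2) := by gcongr
    _ ≤ auxH t ^ 2 * √(1 + 3 * t ^ 2) := by gcongr
end

section
/- For every k ∈ (0,1): (2k⁴ − 2k² + 2)·E(k) + (−k⁴ + 3k² − 2)·K(k) > 0, where K(k) = ∫₀^{π/2} (1 − k² sin²θ)^{−1/2} dθ and E(k) = ∫₀^{π/2} √(1 − k² sin²θ) dθ are the complete elliptic integrals of the first and second kind. -/
open Real

/-- The complete elliptic integral of the second kind. -/
noncomputable def ellipticE (k : ℝ) : ℝ :=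
  ∫ θ in (0 : ℝ)..(π / 2), Real.sqrt (1 - k ^ 2 * Real.sin θ ^ 2)

theorem P_positive (k : ℝ) (hk0 : 0 < k) (hk1 : k < 1) :
    (2 * k ^ 4 - 2 * k ^ 2 + 2) * ellipticE k + (-k ^ 4 + 3 * k ^ 2 - 2) * ellipticK k > 0 := by
  have hk2 : k ^ 2 < 1 := by nlinarith
  have hD : ∀ θ : ℝ, 0 < 1 - k ^ 2 * Real.sin θ ^ 2 := fun θ => by
    nlinarith [Real.sin_sq_le_one θ, sq_nonneg (Real.sin θ), sq_nonneg k]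
  have hS : ∀ θ : ℝ, 0 < √(1 - k ^ 2 * Real.sin θ ^ 2) := fun θ => Real.sqrt_pos.2 (hD θ)
  have hcE : Continuous fun θ : ℝ => √(1 - k ^ 2 * Real.sin θ ^ 2) := by fun_prop
  have hcK : Continuous fun θ : ℝ => 1 / √(1 - k ^ 2 * Real.sin θ ^ 2) :=
    continuous_const.div hcE (fun θ => (hS θ).ne')
  set G : ℝ → ℝ := fun θ => (1 - 2 * (1 + k ^ 2) * Real.sin θ ^ 2 + 3 * k ^ 2 * Real.sin θ ^ 4)
    * (1 / √(1 - k ^ 2 * Real.sin θ ^ 2)) with hG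
  have hcG : Continuous G := by
    apply Continuous.mul _ hcK
    fun_prop
  have hder : ∀ θ : ℝ, HasDerivAt
      (fun θ : ℝ => Real.sin θ * Real.cos θ * √(1 - k ^ 2 * Real.sin θ ^ 2)) (G θ) θ := by
    intro θ
    have h1 := (((((Real.hasDerivAt_sin θ).pow 2).const_mul (k ^ 2)).const_sub 1).sqrt (hD θ).ne')
    have h2 := ((Real.hasDerivAt_sin θ).mul (Real.hasDerivAt_cos θ)).mul h1
    refine h2.congr_deriv ?_
    have hs := Real.sq_sqrt (hD θ).le
    have hp := (hS θ).ne'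
    have hc := Real.cos_sq' θ
    simp only [hG, Pi.mul_apply, Pi.pow_apply]
    set S := √(1 - k ^ 2 * Real.sin θ ^ 2)
    field_simp
    simp only [hs, hc]
    push_cast
    ring_nf
    try simp only [hc]
    try ring
  have hint : ∫ θ in (0 : ℝ)..(π / 2), G θ = 0 := by
    rw [intervalIntegral.integral_eq_sub_of_hasDerivAt (fun θ _ => hder θ)
      (hcG.intervalIntegrable _ _)]
    simp
  have key : (2 * k ^ 4 - 2 * k ^ 2 + 2) * ellipticE k + (-k ^ 4 + 3 * k ^ 2 - 2) * ellipticK k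
      = ∫ θ in (0 : ℝ)..(π / 2), ((2 * k ^ 4 - 2 * k ^ 2 + 2) * √(1 - k ^ 2 * Real.sin θ ^ 2)
        + (-k ^ 4 + 3 * k ^ 2 - 2) * (1 / √(1 - k ^ 2 * Real.sin θ ^ 2)) - k ^ 2 * G θ) := by
    have i1 := (hcE.const_mul (2 * k ^ 4 - 2 * k ^ 2 + 2)).intervalIntegrable
      (μ := MeasureTheory.volume) 0 (π / 2)
    have i2 := (hcK.const_mul (-k ^ 4 + 3 * k ^ 2 - 2)).intervalIntegrable
      (μ := MeasureTheory.volume) 0 (π / 2)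
    have i3 := (hcG.const_mul (k ^ 2)).intervalIntegrable
      (μ := MeasureTheory.volume) 0 (π / 2)
    rw [intervalIntegral.integral_sub (i1.add i2) i3, intervalIntegral.integral_add i1 i2,
      intervalIntegral.integral_const_mul, intervalIntegral.integral_const_mul,
      intervalIntegral.integral_const_mul, hint]
    simp [ellipticE, ellipticK]
  rw [key]
  apply intervalIntegral.intervalIntegral_pos_of_pos_on
  · apply Continuous.intervalIntegrable
    exact ((hcE.const_mul _).add (hcK.const_mul _)).sub (hcG.const_mul _)
  · intro θ hθ
    have hsp : 0 < Real.sin θ := Real.sin_pos_of_pos_of_lt_pi hθ.1 (by linarith [hθ.2, Real.pi_pos])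
    have hs := Real.sq_sqrt (hD θ).le
    have hp := hS θ
    have e : (2 * k ^ 4 - 2 * k ^ 2 + 2) * √(1 - k ^ 2 * Real.sin θ ^ 2)
        + (-k ^ 4 + 3 * k ^ 2 - 2) * (1 / √(1 - k ^ 2 * Real.sin θ ^ 2)) - k ^ 2 * G θ
        = k ^ 4 * ((1 - Real.sin θ ^ 2) * (1 + 3 * Real.sin θ ^ 2)
          + 2 * (1 - k ^ 2) * Real.sin θ ^ 2) / √(1 - k ^ 2 * Real.sin θ ^ 2) := by
      simp only [hG]
      set S := √(1 - k ^ 2 * Real.sin θ ^ 2)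
      have hp' := hp.ne'
      field_simp
      simp only [hs]
      ring
    rw [e]
    have h1 : 0 ≤ 1 - Real.sin θ ^ 2 := by linarith [Real.sin_sq_le_one θ]
    have h2 : 0 < 1 - k ^ 2 := by linarith
    positivity
  · positivity
end

section
/- For every k ∈ (0,1), set r(k) = √(k⁴ − k² + 1), a(k) = (−12k⁶ + 42k⁴ − 56k² + 32)·r(k) + (12k⁸ − 48k⁶ + 82k⁴ − 72k² + 32) and b(k) = (−18k⁴ + 40k² − 32)·r(k) + (18k⁶ − 50k⁴ + 56k² − 32). Then a(k)·K(k) + b(k)·E(k) > 0, where K(k) = ∫₀^{π/2} (1 − k² sin²θ)^{−1/2} dθ and E(k) = ∫₀^{π/2} √(1 − k² sin²θ) dθ are the complete elliptic integrals of the first and second kind. -/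
open Real

lemma aux_pos_s13 (k : ℝ) (hk0 : 0 < k) (hk1 : k < 1) (θ : ℝ) :
    0 < 1 - k ^ 2 * Real.sin θ ^ 2 := by
  have h1 := Real.sin_sq_le_one θ
  have h2 : k ^ 2 < 1 := by nlinarith
  nlinarith [sq_nonneg k, sq_nonneg (Real.sin θ)]

lemma aux_contE (k : ℝ) : Continuous (fun θ : ℝ => Real.sqrt (1 - k ^ 2 * Real.sin θ ^ 2)) := by
  fun_prop

lemma aux_contK (k : ℝ) (hk0 : 0 < k) (hk1 : k < 1) :
    Continuous (fun θ : ℝ => 1 / Real.sqrt (1 - k ^ 2 * Real.sin θ ^ 2)) :=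
  continuous_const.div (aux_contE k)
    (fun θ => (Real.sqrt_pos.2 (aux_pos_s13 k hk0 hk1 θ)).ne')

lemma ellipticK_pos (k : ℝ) (hk0 : 0 < k) (hk1 : k < 1) : 0 < ellipticK k := by
  unfold ellipticK
  apply intervalIntegral.intervalIntegral_pos_of_pos
    ((aux_contK k hk0 hk1).intervalIntegrable _ _)
  · intro θ
    exact one_div_pos.2 (Real.sqrt_pos.2 (aux_pos_s13 k hk0 hk1 θ))
  · positivity

/-- Pointwise bound: compare `1/Δ` with its value at `sin² = 1/2`. -/
lemma aux_pointwise (k : ℝ) (hk0 : 0 < k) (hk1 : k < 1) (θ : ℝ) :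
    k ^ 2 / 2 * (1 / Real.sqrt (1 - k ^ 2 / 2)) * (2 * Real.sin θ ^ 2 - 1) ≤
    (1 - k ^ 2 / 2) * (1 / Real.sqrt (1 - k ^ 2 * Real.sin θ ^ 2))
      - Real.sqrt (1 - k ^ 2 * Real.sin θ ^ 2) := by
  have hp := aux_pos_s13 k hk0 hk1 θ
  have hq : 0 < 1 - k ^ 2 / 2 := by nlinarith
  set d := Real.sqrt (1 - k ^ 2 * Real.sin θ ^ 2) with hd
  set e := Real.sqrt (1 - k ^ 2 / 2) with he
  have hd0 : 0 < d := Real.sqrt_pos.2 hp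
  have he0 : 0 < e := Real.sqrt_pos.2 hq
  have hd2 : d ^ 2 = 1 - k ^ 2 * Real.sin θ ^ 2 := Real.sq_sqrt hp.le
  have he2 : e ^ 2 = 1 - k ^ 2 / 2 := Real.sq_sqrt hq.le
  have h1 : k ^ 2 / 2 * (1 / e) * (2 * Real.sin θ ^ 2 - 1) = (e ^ 2 - d ^ 2) / e := by
    rw [hd2, he2]; field_simp; ring
  have h2 : (1 - k ^ 2 / 2) * (1 / d) - d = (e ^ 2 - d ^ 2) / d := by
    rw [← he2]; field_simp
  rw [h1, h2, div_le_div_iff₀ he0 hd0]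
  nlinarith [mul_nonneg (add_pos hd0 he0).le (sq_nonneg (e - d))]

lemma ellipticE_le (k : ℝ) (hk0 : 0 < k) (hk1 : k < 1) :
    ellipticE k ≤ (1 - k ^ 2 / 2) * ellipticK k := by
  have hK := (aux_contK k hk0 hk1).intervalIntegrable (μ := MeasureTheory.volume) 0 (π / 2)
  have hE := (aux_contE k).intervalIntegrable (μ := MeasureTheory.volume) 0 (π / 2)
  have hmono := intervalIntegral.integral_mono (a := 0) (b := π / 2)
    (μ := MeasureTheory.volume) (by positivity)
    (Continuous.intervalIntegrable (by fun_prop) _ _)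
    ((hK.const_mul (1 - k ^ 2 / 2)).sub hE) (aux_pointwise k hk0 hk1)
  have hz : ∫ θ in (0 : ℝ)..(π / 2),
      k ^ 2 / 2 * (1 / Real.sqrt (1 - k ^ 2 / 2)) * (2 * Real.sin θ ^ 2 - 1) = 0 := by
    rw [intervalIntegral.integral_const_mul, intervalIntegral.integral_sub
      (Continuous.intervalIntegrable (by fun_prop) _ _)
      (Continuous.intervalIntegrable (by fun_prop) _ _),
      intervalIntegral.integral_const_mul, integral_sin_sq]
    simp
    right
    ring
  rw [hz, intervalIntegral.integral_sub (hK.const_mul _) hE,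
    intervalIntegral.integral_const_mul] at hmono
  unfold ellipticE ellipticK
  linarith

theorem numerator_positive (k : ℝ) (hk0 : 0 < k) (hk1 : k < 1)
    (r a b : ℝ)
    (hr : r = Real.sqrt (k ^ 4 - k ^ 2 + 1))
    (ha : a = (-12 * k ^ 6 + 42 * k ^ 4 - 56 * k ^ 2 + 32) * r
      + (12 * k ^ 8 - 48 * k ^ 6 + 82 * k ^ 4 - 72 * k ^ 2 + 32))
    (hb : b = (-18 * k ^ 4 + 40 * k ^ 2 - 32) * r
      + (18 * k ^ 6 - 50 * k ^ 4 + 56 * k ^ 2 - 32)) :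
    a * ellipticK k + b * ellipticE k > 0 := by
  have hK := ellipticK_pos k hk0 hk1
  have hE := ellipticE_le k hk0 hk1
  have hr0 : 0 ≤ r := hr ▸ Real.sqrt_nonneg _
  obtain ⟨m, hm⟩ : ∃ m, m = k ^ 2 := ⟨_, rfl⟩
  have hm0 : 0 < m := by rw [hm]; positivity
  have hm1 : m < 1 := by rw [hm]; nlinarith
  have hb0 : b ≤ 0 := by
    have e : b = -((18 * m ^ 2 - 40 * m + 32) * r
        + (32 - 56 * m + 50 * m ^ 2 - 18 * m ^ 3)) := by rw [hb, hm]; ring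
    have h1 : 0 ≤ 18 * m ^ 2 - 40 * m + 32 := by nlinarith [sq_nonneg (9 * m - 10)]
    have h2 : 0 ≤ 32 - 56 * m + 50 * m ^ 2 - 18 * m ^ 3 := by
      nlinarith [mul_nonneg (sub_nonneg.2 hm1.le) (sq_nonneg (9 * m - 8)), sq_nonneg m]
    rw [e]
    have := mul_nonneg h1 hr0
    linarith
  have hc : 0 < a + b * (1 - k ^ 2 / 2) := by
    have e : a + b * (1 - k ^ 2 / 2) =
        m ^ 2 * ((4 - 3 * m) * r + (4 - 5 * m + 3 * m ^ 2)) := by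
      rw [ha, hb, hm]; ring
    have h1 : 0 ≤ (4 - 3 * m) * r := mul_nonneg (by linarith) hr0
    have h2 : 0 < 4 - 5 * m + 3 * m ^ 2 := by nlinarith [sq_nonneg (6 * m - 5)]
    rw [e]
    positivity
  have h3 : b * ((1 - k ^ 2 / 2) * ellipticK k) ≤ b * ellipticE k :=
    mul_le_mul_of_nonpos_left hE hb0
  have h4 := mul_pos hc hK
  nlinarith
end

section
/- For every k ∈ (0,1), set r(k) = √(k⁴ − k² + 1), a(k) = (−12k⁶ + 42k⁴ − 56k² + 32)·r(k) + (12k⁸ − 48k⁶ + 82k⁴ − 72k² + 32) and b(k) = (−18k⁴ + 40k² − 32)·r(k) + (18k⁶ − 50k⁴ + 56k² − 32). Then 2(a(k) + b(k)) − b(k)·k² > 0. -/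
theorem M_positive (k : ℝ) (hk0 : 0 < k) (hk1 : k < 1)
    (r a b : ℝ)
    (hr : r = Real.sqrt (k ^ 4 - k ^ 2 + 1))
    (ha : a = (-12 * k ^ 6 + 42 * k ^ 4 - 56 * k ^ 2 + 32) * r
      + (12 * k ^ 8 - 48 * k ^ 6 + 82 * k ^ 4 - 72 * k ^ 2 + 32))
    (hb : b = (-18 * k ^ 4 + 40 * k ^ 2 - 32) * r
      + (18 * k ^ 6 - 50 * k ^ 4 + 56 * k ^ 2 - 32)) :
    2 * (a + b) - b * k ^ 2 > 0 := by
  have hr0 : 0 ≤ r := hr ▸ Real.sqrt_nonneg _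
  have hx : k ^ 2 < 1 := by nlinarith
  have h : 2 * (a + b) - b * k ^ 2
      = k ^ 4 * ((8 - 6 * k ^ 2) * r + (6 * (k ^ 2) ^ 2 - 10 * k ^ 2 + 8)) := by
    rw [ha, hb]; ring
  rw [h]
  have h1 : 0 ≤ (8 - 6 * k ^ 2) * r := mul_nonneg (by linarith) hr0
  have h2 : 0 < 6 * (k ^ 2) ^ 2 - 10 * k ^ 2 + 8 := by nlinarith [sq_nonneg (6 * k ^ 2 - 5)]
  have h3 : 0 < k ^ 4 := by positivity
  exact mul_pos h3 (by linarith)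
end

section
/- For every k ∈ (0,1), set r(k) = √(k⁴ − k² + 1), a(k) = (−12k⁶ + 42k⁴ − 56k² + 32)·r(k) + (12k⁸ − 48k⁶ + 82k⁴ − 72k² + 32) and b(k) = (−18k⁴ + 40k² − 32)·r(k) + (18k⁶ − 50k⁴ + 56k² − 32). Then a(k)·K(k) + b(k)·E(k) ≥ (π/4)·(2(a(k) + b(k)) − b(k)·k²), where K(k) = ∫₀^{π/2} (1 − k² sin²θ)^{−1/2} dθ and E(k) = ∫₀^{π/2} √(1 − k² sin²θ) dθ. -/
open Real

/-- Pointwise bound (Chebyshev-type): with `g(s) = 1/√(1-ms) - 1` nondecreasing and nonnegative. -/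
lemma pointwise_bound (m s a b : ℝ) (hm0 : 0 < m) (hm1 : m < 1) (hs0 : 0 ≤ s) (hs1 : s ≤ 1)
    (hb : b ≤ 0) (hM : 0 ≤ 2 * (a + b) - b * m) :
    (a + b - b * m * s) + (-b) * m * (1 / √(1 - m * (1 / 2)) - 1) * (s - 1 / 2)
      ≤ a * (1 / √(1 - m * s)) + b * √(1 - m * s) := by
  have hpos : 0 < 1 - m * s := by nlinarith
  have hpos2 : 0 < 1 - m * (1 / 2) := by linarith
  have hu : 0 < √(1 - m * s) := Real.sqrt_pos.2 hpos
  have hu2 : 0 < √(1 - m * (1 / 2)) := Real.sqrt_pos.2 hpos2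
  have hule : √(1 - m * s) ≤ 1 := Real.sqrt_le_one.2 (by nlinarith)
  have hg : 1 ≤ 1 / √(1 - m * s) := by rw [le_div_iff₀ hu]; linarith
  have hcheb : 0 ≤ (s - 1 / 2) * (1 / √(1 - m * s) - 1 / √(1 - m * (1 / 2))) := by
    rcases le_total s (1 / 2) with h | h
    · have : 1 / √(1 - m * s) ≤ 1 / √(1 - m * (1 / 2)) :=
        one_div_le_one_div_of_le hu2 (Real.sqrt_le_sqrt (by nlinarith))
      exact mul_nonneg_of_nonpos_of_nonpos (by linarith) (by linarith)
    · have : 1 / √(1 - m * (1 / 2)) ≤ 1 / √(1 - m * s) :=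
        one_div_le_one_div_of_le hu (Real.sqrt_le_sqrt (by nlinarith))
      exact mul_nonneg (by linarith) (by linarith)
  have hsq : √(1 - m * s) = (1 - m * s) * (1 / √(1 - m * s)) := by
    rw [mul_one_div, eq_div_iff hu.ne']
    exact Real.mul_self_sqrt hpos.le
  have e : a * (1 / √(1 - m * s)) + b * √(1 - m * s)
      = (a + b - b * m * s) * (1 / √(1 - m * s)) := by
    nth_rewrite 2 [hsq]; ring
  rw [e]
  generalize 1 / √(1 - m * s) = x at *
  generalize 1 / √(1 - m * (1 / 2)) = y at *
  have h1 := mul_nonneg hM (sub_nonneg.2 hg)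
  have h2 := mul_nonneg (mul_nonneg (neg_nonneg.2 hb) hm0.le) hcheb
  nlinarith

theorem numerator_lower_bound (k : ℝ) (hk0 : 0 < k) (hk1 : k < 1)
    (r a b : ℝ)
    (hr : r = Real.sqrt (k ^ 4 - k ^ 2 + 1))
    (ha : a = (-12 * k ^ 6 + 42 * k ^ 4 - 56 * k ^ 2 + 32) * r
      + (12 * k ^ 8 - 48 * k ^ 6 + 82 * k ^ 4 - 72 * k ^ 2 + 32))
    (hb : b = (-18 * k ^ 4 + 40 * k ^ 2 - 32) * r
      + (18 * k ^ 6 - 50 * k ^ 4 + 56 * k ^ 2 - 32)) :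
    a * ellipticK k + b * ellipticE k ≥ π / 4 * (2 * (a + b) - b * k ^ 2) := by
  have hr0 : 0 ≤ r := hr ▸ Real.sqrt_nonneg _
  have hm0 : 0 < k ^ 2 := by positivity
  have hm1 : k ^ 2 < 1 := by nlinarith
  obtain ⟨m, hm⟩ : ∃ m, m = k ^ 2 := ⟨_, rfl⟩
  have hb' : b = -((18 * m ^ 2 - 40 * m + 32) * r
      + ((1 - m) * (18 * m ^ 2 - 32 * m + 24) + 8)) := by rw [hb, hm]; ring
  have hM' : 2 * (a + b) - b * m = m ^ 2 * ((8 - 6 * m) * r + (6 * m ^ 2 - 10 * m + 8)) := by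
    rw [ha, hb, hm]; ring
  unfold ellipticK ellipticE
  rw [← hm] at hm0 hm1 ⊢
  have hbn : b ≤ 0 := by
    have h1 : 0 ≤ (18 * m ^ 2 - 40 * m + 32) * r :=
      mul_nonneg (by nlinarith [sq_nonneg (9 * m - 10)]) hr0
    have h2 : 0 ≤ (1 - m) * (18 * m ^ 2 - 32 * m + 24) :=
      mul_nonneg (by linarith) (by nlinarith [sq_nonneg (9 * m - 8)])
    linarith
  have hM : 0 ≤ 2 * (a + b) - b * m := by
    rw [hM']
    have h1 : 0 ≤ (8 - 6 * m) * r := mul_nonneg (by linarith) hr0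
    have h2 : 0 ≤ 6 * m ^ 2 - 10 * m + 8 := by nlinarith [sq_nonneg (6 * m - 5)]
    exact mul_nonneg (sq_nonneg _) (by linarith)
  have hs1 : ∀ θ : ℝ, sin θ ^ 2 ≤ 1 := fun θ => Real.sin_sq_le_one θ
  have hne : ∀ θ : ℝ, √(1 - m * sin θ ^ 2) ≠ 0 := fun θ =>
    (Real.sqrt_pos.2 (by nlinarith [hs1 θ, sq_nonneg (sin θ)])).ne'
  have cE : Continuous fun θ : ℝ => √(1 - m * sin θ ^ 2) := by fun_prop
  have cK : Continuous fun θ : ℝ => 1 / √(1 - m * sin θ ^ 2) :=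
    continuous_const.div cE hne
  rw [← intervalIntegral.integral_const_mul, ← intervalIntegral.integral_const_mul,
    ← intervalIntegral.integral_add ((cK.const_mul a).intervalIntegrable _ _)
      ((cE.const_mul b).intervalIntegrable _ _)]
  obtain ⟨c, hc⟩ : ∃ c, c = (-b) * m * (1 / √(1 - m * (1 / 2)) - 1) := ⟨_, rfl⟩
  have hS : ∫ θ in (0 : ℝ)..(π / 2), sin θ ^ 2 = π / 4 := by
    rw [integral_sin_sq]; simp; ring
  have hI : ∫ θ in (0 : ℝ)..(π / 2), ((a + b - c / 2) + (c - b * m) * sin θ ^ 2)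
      = π / 4 * (2 * (a + b) - b * m) := by
    rw [intervalIntegral.integral_add (Continuous.intervalIntegrable (by fun_prop) _ _)
      (Continuous.intervalIntegrable (by fun_prop) _ _), intervalIntegral.integral_const_mul, hS,
      intervalIntegral.integral_const, smul_eq_mul]
    ring
  rw [← hI, ge_iff_le]
  refine intervalIntegral.integral_mono_on (by positivity)
    (Continuous.intervalIntegrable (by fun_prop) _ _)
    (((cK.const_mul a).add (cE.const_mul b)).intervalIntegrable _ _) ?_
  intro θ _
  have h := pointwise_bound m (sin θ ^ 2) a b hm0 hm1 (sq_nonneg _) (hs1 θ) hbn hM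
  rw [← hc] at h
  linarith
end

section
/- Define, for k ∈ (0,1): r(k) = √(k⁴ − k² + 1), q(k) = k² − 1 − r(k), K(k) = ∫₀^{π/2} (1 − k² sin²θ)^{−1/2} dθ, and Π(q,k) = ∫₀^{π/2} ((1 − q sin²θ)·√(1 − k² sin²θ))^{−1} dθ. Then the function G(k) = 4·√(2 − k² + 2r(k)) · ((q(k) − 1)·Π(q(k),k) + K(k)) / q(k) is strictly increasing on (0,1). -/
open Real

/-- The complete elliptic integral of the third kind. -/
noncomputable def ellipticPi (q k : ℝ) : ℝ :=
  ∫ θ in (0 : ℝ)..(π / 2),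
    1 / ((1 - q * Real.sin θ ^ 2) * Real.sqrt (1 - k ^ 2 * Real.sin θ ^ 2))

/-- `r(k) = √(k⁴ − k² + 1)`. -/
noncomputable def rfun (k : ℝ) : ℝ := Real.sqrt (k ^ 4 - k ^ 2 + 1)

/-- `q(k) = k² − 1 − r(k)`. -/
noncomputable def qfun (k : ℝ) : ℝ := k ^ 2 - 1 - rfun k

/-- The squared L² norm (over one period) of the normalized cnoidal wave. -/
noncomputable def Gfun (k : ℝ) : ℝ :=
  4 * Real.sqrt (2 - k ^ 2 + 2 * rfun k) *
    ((qfun k - 1) * ellipticPi (qfun k) k + ellipticK k) / qfun k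


/-- The integrand after the substitution `θ = arctan (u / A)`. -/
noncomputable def Hfun (x u : ℝ) : ℝ :=
  1 / ((1 + (1 + x) / (1 + 2 * x) * u ^ 2) *
    Real.sqrt (1 + 1 / (1 + 2 * x) * u ^ 2 + (1 - x ^ 2) / (3 * (1 + 2 * x) ^ 2) * u ^ 4))

lemma Hfun_lt {x y u : ℝ} (hx : 0 < x) (hxy : x < y) (hy : y < 1) (hu : 0 < u) :
    Hfun x u < Hfun y u := by
  have h1 : (1 + y) / (1 + 2 * y) < (1 + x) / (1 + 2 * x) := by
    rw [div_lt_div_iff₀ (by linarith) (by linarith)]; nlinarith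
  have h2 : 1 / (1 + 2 * y) < 1 / (1 + 2 * x) := by
    rw [div_lt_div_iff₀ (by linarith) (by linarith)]; nlinarith
  have h3 : (1 - y ^ 2) / (3 * (1 + 2 * y) ^ 2) ≤ (1 - x ^ 2) / (3 * (1 + 2 * x) ^ 2) := by
    have : 0 ≤ 1 - y ^ 2 := by nlinarith
    apply div_le_div₀
    · nlinarith
    · nlinarith
    · positivity
    · nlinarith
  have h4 : 0 ≤ (1 - y ^ 2) / (3 * (1 + 2 * y) ^ 2) :=
    div_nonneg (by nlinarith) (by positivity)
  have h5 : 0 < (1 + y) / (1 + 2 * y) := div_pos (by linarith) (by linarith)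
  have h6 : 0 < 1 / (1 + 2 * y) := div_pos (by linarith) (by linarith)
  unfold Hfun
  apply one_div_lt_one_div_of_lt
  · positivity
  · apply mul_lt_mul
    · gcongr
    · apply Real.sqrt_le_sqrt
      gcongr
    · positivity
    · have := h5.trans h1
      positivity

lemma image_arctan {A : ℝ} (hA : 0 < A) :
    (fun u : ℝ => arctan (u / A)) '' Set.Ioi 0 = Set.Ioo 0 (π / 2) := by
  ext θ
  simp only [Set.mem_image, Set.mem_Ioi, Set.mem_Ioo]
  constructor
  · rintro ⟨u, hu, rfl⟩
    exact ⟨Real.arctan_pos.2 (by positivity), arctan_lt_pi_div_two _⟩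
  · rintro ⟨h0, h1⟩
    refine ⟨A * tan θ, mul_pos hA (tan_pos_of_pos_of_lt_pi_div_two h0 h1), ?_⟩
    rw [mul_div_cancel_left₀ _ hA.ne']
    exact arctan_tan (by linarith) h1

lemma r_sq (k : ℝ) : rfun k ^ 2 = (2 - k ^ 2) ^ 2 - 3 * (1 - k ^ 2) := by
  unfold rfun
  rw [Real.sq_sqrt (by nlinarith [sq_nonneg (k ^ 2 - 1)])]; ring

lemma r_pos (k : ℝ) : 0 < rfun k := by
  unfold rfun
  exact Real.sqrt_pos.2 (by nlinarith [sq_nonneg (k ^ 2 - 1 / 2)])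

lemma key_pointwise {m r A u : ℝ} (hm1 : m < 1) (hm0 : 0 < m) (hr : 0 < r) (hA : 0 < A)
    (hA2 : A ^ 2 = 2 - m + 2 * r) (hr2 : r ^ 2 = (2 - m) ^ 2 - 3 * (1 - m)) :
    |1 / (1 + (u / A) ^ 2) * (1 / A)| • (A * (cos (arctan (u / A)) ^ 2 /
      ((1 - (m - 1 - r) * sin (arctan (u / A)) ^ 2) *
        Real.sqrt (1 - m * sin (arctan (u / A)) ^ 2)))) = Hfun (r / (2 - m)) u := by
  have hn : (0 : ℝ) < 2 - m := by linarith
  set v := u / A with hv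
  have huv : u = A * v := by rw [hv]; field_simp
  have hw : 0 < 1 + v ^ 2 := by positivity
  have hs : sin (arctan v) ^ 2 = v ^ 2 / (1 + v ^ 2) := by
    rw [sin_arctan, div_pow, Real.sq_sqrt hw.le]
  have hc : cos (arctan v) ^ 2 = 1 / (1 + v ^ 2) := by
    rw [cos_arctan, div_pow, Real.sq_sqrt hw.le]; norm_num
  have hm' : 0 < 1 - m := by linarith
  rw [hs, hc, abs_of_pos (by positivity), smul_eq_mul]
  have e1 : 1 - (m - 1 - r) * (v ^ 2 / (1 + v ^ 2)) = (1 + (2 - m + r) * v ^ 2) / (1 + v ^ 2) := by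
    field_simp; ring
  have e2 : 1 - m * (v ^ 2 / (1 + v ^ 2)) =
      ((1 + v ^ 2) * (1 + (1 - m) * v ^ 2)) / (1 + v ^ 2) ^ 2 := by
    field_simp; ring
  have hx : 1 + 2 * (r / (2 - m)) = A ^ 2 / (2 - m) := by rw [hA2]; field_simp
  have e3 : 1 + (1 + r / (2 - m)) / (1 + 2 * (r / (2 - m))) * u ^ 2
      = 1 + (2 - m + r) * v ^ 2 := by
    rw [hx, huv]; field_simp
  have e4 : 1 + 1 / (1 + 2 * (r / (2 - m))) * u ^ 2 +
      (1 - (r / (2 - m)) ^ 2) / (3 * (1 + 2 * (r / (2 - m))) ^ 2) * u ^ 4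
      = (1 + v ^ 2) * (1 + (1 - m) * v ^ 2) := by
    rw [hx, huv, div_pow, hr2]; field_simp; ring
  unfold Hfun
  rw [e3, e4, e1, e2, Real.sqrt_div (by positivity), Real.sqrt_sq hw.le]
  have hS : 0 < Real.sqrt ((1 + v ^ 2) * (1 + (1 - m) * v ^ 2)) := by positivity
  have hB : 0 < 1 + (2 - m + r) * v ^ 2 := by positivity
  field_simp

lemma G_eq {k : ℝ} (h0 : 0 < k) (h1 : k < 1) :
    MeasureTheory.IntegrableOn (Hfun (rfun k / (2 - k ^ 2))) (Set.Ioi 0) ∧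
    Gfun k = 4 * ∫ u in Set.Ioi (0 : ℝ), Hfun (rfun k / (2 - k ^ 2)) u := by
  have hm1 : k ^ 2 < 1 := by nlinarith
  have hm0 : 0 < k ^ 2 := by positivity
  have hr := r_pos k
  have hr2 := r_sq k
  have hAA : 0 < 2 - k ^ 2 + 2 * rfun k := by linarith
  set A := Real.sqrt (2 - k ^ 2 + 2 * rfun k) with hAdef
  have hA : 0 < A := Real.sqrt_pos.2 hAA
  have hA2 : A ^ 2 = 2 - k ^ 2 + 2 * rfun k := Real.sq_sqrt hAA.le
  have hq : qfun k < 0 := by unfold qfun; linarith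
  have hs1 : ∀ θ : ℝ, 0 < 1 - qfun k * sin θ ^ 2 := fun θ => by
    nlinarith [sq_nonneg (sin θ)]
  have hs2 : ∀ θ : ℝ, 0 < 1 - k ^ 2 * sin θ ^ 2 := fun θ => by
    nlinarith [sq_nonneg (sin θ), sin_sq_le_one θ]
  have hs3 : ∀ θ : ℝ, 0 < Real.sqrt (1 - k ^ 2 * sin θ ^ 2) := fun θ => Real.sqrt_pos.2 (hs2 θ)
  set g : ℝ → ℝ := fun θ => A * (cos θ ^ 2 /
      ((1 - qfun k * sin θ ^ 2) * Real.sqrt (1 - k ^ 2 * sin θ ^ 2))) with hg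
  have hgc : Continuous g := by
    apply Continuous.mul continuous_const
    apply Continuous.div (by fun_prop) (by fun_prop)
    intro θ; exact (mul_pos (hs1 θ) (hs3 θ)).ne'
  have hc1 : Continuous fun θ : ℝ => 1 / Real.sqrt (1 - k ^ 2 * sin θ ^ 2) :=
    Continuous.div (by fun_prop) (by fun_prop) fun θ => (hs3 θ).ne'
  have hc2 : Continuous fun θ : ℝ =>
      1 / ((1 - qfun k * sin θ ^ 2) * Real.sqrt (1 - k ^ 2 * sin θ ^ 2)) :=
    Continuous.div (by fun_prop) (by fun_prop) fun θ => (mul_pos (hs1 θ) (hs3 θ)).ne'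
  have hG : Gfun k = 4 * ∫ θ in (0 : ℝ)..(π / 2), g θ := by
    have : (qfun k - 1) * ellipticPi (qfun k) k + ellipticK k =
        qfun k * ∫ θ in (0 : ℝ)..(π / 2), cos θ ^ 2 /
      ((1 - qfun k * sin θ ^ 2) * Real.sqrt (1 - k ^ 2 * sin θ ^ 2)) := by
      unfold ellipticPi ellipticK
      rw [← intervalIntegral.integral_const_mul, ← intervalIntegral.integral_const_mul,
        ← intervalIntegral.integral_add]
      · apply intervalIntegral.integral_congr
        intro θ _
        have a1 := hs1 θ
        have a3 := hs3 θ
        simp only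
        rw [cos_sq']
        field_simp
        ring
      · exact (continuous_const.mul hc2).intervalIntegrable _ _
      · exact hc1.intervalIntegrable _ _
    unfold Gfun
    rw [this, hg, intervalIntegral.integral_const_mul, ← hAdef]
    generalize (∫ θ in (0 : ℝ)..(π / 2), cos θ ^ 2 /
      ((1 - qfun k * sin θ ^ 2) * Real.sqrt (1 - k ^ 2 * sin θ ^ 2))) = I
    have := hq.ne
    field_simp
  have hder : ∀ u ∈ Set.Ioi (0 : ℝ), HasDerivWithinAt (fun u : ℝ => arctan (u / A))
      (1 / (1 + (u / A) ^ 2) * (1 / A)) (Set.Ioi 0) u := fun u _ =>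
    (((hasDerivAt_id u).div_const A).arctan).hasDerivWithinAt
  have hinj : Set.InjOn (fun u : ℝ => arctan (u / A)) (Set.Ioi 0) := by
    intro a _ b _ hab
    have := arctan_injective hab
    field_simp at this
    exact this
  have hpt : ∀ u ∈ Set.Ioi (0 : ℝ), |1 / (1 + (u / A) ^ 2) * (1 / A)| • g (arctan (u / A))
      = Hfun (rfun k / (2 - k ^ 2)) u := fun u _ =>
    key_pointwise hm1 hm0 hr hA hA2 hr2
  have hgi : MeasureTheory.IntegrableOn g (Set.Ioo 0 (π / 2)) :=
    (hgc.integrableOn_Icc (a := 0) (b := π / 2)).mono_set Set.Ioo_subset_Icc_self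
  constructor
  · rw [← image_arctan hA,
      MeasureTheory.integrableOn_image_iff_integrableOn_abs_deriv_smul measurableSet_Ioi
        hder hinj] at hgi
    exact hgi.congr_fun hpt measurableSet_Ioi
  · rw [hG, intervalIntegral.integral_of_le (by positivity),
      MeasureTheory.integral_Ioc_eq_integral_Ioo, ← image_arctan hA,
      MeasureTheory.integral_image_eq_integral_abs_deriv_smul measurableSet_Ioi hder hinj,
      MeasureTheory.setIntegral_congr_fun measurableSet_Ioi hpt]

lemma x_lt {a b : ℝ} (ha : 0 < a) (hab : a < b) (hb : b < 1) :
    rfun a / (2 - a ^ 2) < rfun b / (2 - b ^ 2) := by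
  have h1 : a ^ 2 < b ^ 2 := by nlinarith
  have h2 : b ^ 2 < 1 := by nlinarith
  have h0 : 0 < a ^ 2 := by positivity
  rw [div_lt_div_iff₀ (by linarith) (by linarith)]
  apply lt_of_pow_lt_pow_left₀ 2 (mul_nonneg (r_pos b).le (by linarith))
  rw [mul_pow, mul_pow, r_sq, r_sq]
  have : 0 < (b ^ 2 - a ^ 2) * (1 - (1 - a ^ 2) * (1 - b ^ 2)) :=
    mul_pos (by linarith) (by nlinarith)
  nlinarith

theorem G_strict_mono : StrictMonoOn Gfun (Set.Ioo (0 : ℝ) 1) := by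
  rintro a ⟨ha0, ha1⟩ b ⟨hb0, hb1⟩ hab
  obtain ⟨ia, ea⟩ := G_eq ha0 ha1
  obtain ⟨ib, eb⟩ := G_eq hb0 hb1
  have hb2 : b ^ 2 < 1 := by nlinarith
  have ha2 : a ^ 2 < 1 := by nlinarith
  have hx : 0 < rfun a / (2 - a ^ 2) := div_pos (r_pos a) (by linarith)
  have hy : rfun b / (2 - b ^ 2) < 1 := by
    rw [div_lt_one (by linarith)]
    apply lt_of_pow_lt_pow_left₀ 2 (by linarith)
    rw [r_sq]; linarith
  have hlt := x_lt ha0 hab hb1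
  rw [ea, eb]
  have hpos : 0 < ∫ u in Set.Ioi (0 : ℝ),
      (Hfun (rfun b / (2 - b ^ 2)) u - Hfun (rfun a / (2 - a ^ 2)) u) := by
    have hp : ∀ u ∈ Set.Ioi (0 : ℝ),
        0 < Hfun (rfun b / (2 - b ^ 2)) u - Hfun (rfun a / (2 - a ^ 2)) u :=
      fun u hu => sub_pos.2 (Hfun_lt hx hlt hy hu)
    rw [MeasureTheory.setIntegral_pos_iff_support_of_nonneg_ae
      (MeasureTheory.ae_restrict_of_forall_mem measurableSet_Ioi fun u hu => (hp u hu).le)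
      (ib.sub ia)]
    rw [Set.inter_eq_right.2 fun u hu => Function.mem_support.2 (hp u hu).ne']
    simp
  rw [MeasureTheory.integral_sub ib ia] at hpos
  linarith
end

section
/- For every k ∈ (0,1), with r(k) = √(k⁴ − k² + 1) and K(k) = ∫₀^{π/2} (1 − k² sin²θ)^{−1/2} dθ: 3·(1 − k²)·√(2 − k² + 2r(k))·K(k) < π·(2 − k² + r(k)). -/
open Real

theorem ellipticK_le_aux (k : ℝ) (hk0 : 0 < k) (hk1 : k < 1) :
    ellipticK k ≤ π / 2 * (1 / Real.sqrt (1 - k ^ 2)) := by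
  have hm : 0 < 1 - k ^ 2 := by nlinarith
  have hle : ∀ θ : ℝ, 1 - k ^ 2 ≤ 1 - k ^ 2 * Real.sin θ ^ 2 := fun θ => by
    nlinarith [Real.sin_sq_le_one θ, sq_nonneg k]
  have h : ellipticK k ≤ ∫ _θ in (0 : ℝ)..(π / 2), 1 / Real.sqrt (1 - k ^ 2) := by
    unfold ellipticK
    apply intervalIntegral.integral_mono_on (by positivity)
    · apply Continuous.intervalIntegrable
      apply Continuous.div continuous_const (by fun_prop)
      intro θ
      exact (Real.sqrt_pos.2 (hm.trans_le (hle θ))).ne'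
    · exact intervalIntegrable_const
    · intro θ _
      exact one_div_le_one_div_of_le (Real.sqrt_pos.2 hm) (Real.sqrt_le_sqrt (hle θ))
  simpa using h

theorem snoidal_amplitude_range (k : ℝ) (hk0 : 0 < k) (hk1 : k < 1) :
    3 * (1 - k ^ 2) * Real.sqrt (2 - k ^ 2 + 2 * Real.sqrt (k ^ 4 - k ^ 2 + 1)) * ellipticK k
      < π * (2 - k ^ 2 + Real.sqrt (k ^ 4 - k ^ 2 + 1)) := by
  have hK := ellipticK_le_aux k hk0 hk1
  have hs0 : 0 < 1 - k ^ 2 := by nlinarith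
  have hs1 : 1 - k ^ 2 < 1 := by nlinarith
  have e1 : k ^ 4 - k ^ 2 + 1 = (1 - k ^ 2) ^ 2 - (1 - k ^ 2) + 1 := by ring
  have e2 : 2 - k ^ 2 = 1 + (1 - k ^ 2) := by ring
  rw [e1, e2]
  generalize 1 - k ^ 2 = s at *
  have hr2 : Real.sqrt (s ^ 2 - s + 1) ^ 2 = s ^ 2 - s + 1 :=
    Real.sq_sqrt (by nlinarith)
  have hr0 := Real.sqrt_nonneg (s ^ 2 - s + 1)
  generalize Real.sqrt (s ^ 2 - s + 1) = r at *
  have hr1 : r ≤ 1 := by nlinarith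
  have hq2 : Real.sqrt (1 + s + 2 * r) ^ 2 = 1 + s + 2 * r := Real.sq_sqrt (by linarith)
  have hq0 := Real.sqrt_nonneg (1 + s + 2 * r)
  generalize Real.sqrt (1 + s + 2 * r) = q at *
  have ht2 : Real.sqrt s ^ 2 = s := Real.sq_sqrt hs0.le
  have ht0 := Real.sqrt_pos.2 hs0
  generalize Real.sqrt s = t at *
  have key : 3 * t * q < 2 * (1 + s + r) := by
    apply lt_of_pow_lt_pow_left₀ 2 (by linarith)
    have : (3 * t * q) ^ 2 = 9 * s * (1 + s + 2 * r) := by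
      rw [mul_pow, mul_pow, ht2, hq2]; ring
    rw [this]
    have h2 : 0 < 8 - 5 * s - s ^ 2 + r * (8 - 10 * s) := by
      rcases le_or_gt s (4 / 5) with h | h
      · have : 0 ≤ r * (8 - 10 * s) := mul_nonneg hr0 (by linarith)
        nlinarith
      · have : 0 ≤ (1 - r) * (10 * s - 8) := mul_nonneg (by linarith) (by linarith)
        nlinarith
    nlinarith
  calc 3 * s * q * ellipticK k ≤ 3 * s * q * (π / 2 * (1 / t)) := by gcongr
    _ = π / 2 * (3 * t * q) := by
      rw [← ht2]; field_simp
    _ < π / 2 * (2 * (1 + s + r)) := by gcongr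
    _ = _ := by ring
end
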